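/- arXiv:2203.04784 — 10 statements merged into one kernel-verified Lean document; each statement's English description precedes it below -/
import Mathlib

section
/- Let s ≥ 1 and let a_{ik} (for 0 ≤ k < i ≤ s) be real numbers that are all strictly positive. Then there exist real numbers α_{ik} and β_{ik} (for 0 ≤ k < i ≤ s) such that α_{ik} > 0 for all i,k, Σ_{k=0}^{i−1} α_{ik} = 1 for every 1 ≤ i ≤ s, β_{ik} = a_{ik} − Σ_{j=k+1}^{i−1} α_{ij} a_{jk} for all 0 ≤ k < i ≤ s, and β_{ik} ≥ 0 for all i,k. (In other words, an explicit Runge–Kutta scheme whose strictly lower-triangular Butcher array has all positive entries admits a Shu–Osher decomposition satisfying the RK-SSP condition.) -/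
open Filter Topology in
/-- Finitely many constraints `ε * c < d` with `d > 0` hold for some common `ε > 0`. -/
theorem exists_pos_forall_mul_lt {ι : Type*} (t : Finset ι) (c d : ι → ℝ)
    (hd : ∀ x ∈ t, 0 < d x) : ∃ ε : ℝ, 0 < ε ∧ ∀ x ∈ t, ε * c x < d x := by
  have h : ∀ᶠ ε : ℝ in 𝓝[>] 0, ∀ x ∈ t, ε * c x < d x := by
    rw [Filter.eventually_all_finset]
    intro x hx
    have hc : Tendsto (fun ε : ℝ => ε * c x) (𝓝[>] 0) (𝓝 (0 * c x)) :=
      ((continuous_id.mul continuous_const).tendsto 0).mono_left nhdsWithin_le_nhds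
    exact hc.eventually_lt_const (by simpa using hd x hx)
  obtain ⟨ε, hε, hε0⟩ := (h.and self_mem_nhdsWithin).exists
  exact ⟨ε, hε0, hε⟩

/-- If all strictly lower-triangular Butcher coefficients `a i k`
(`0 ≤ k < i ≤ s`) of an explicit Runge–Kutta method are strictly positive, then
there exists a Shu–Osher decomposition `(α, β)` satisfying the RK-SSP condition. -/
theorem rk_positive_butcher_implies_ssp
    (s : ℕ) (hs : 1 ≤ s) (a : ℕ → ℕ → ℝ)
    (ha : ∀ i k, k < i → i ≤ s → 0 < a i k) :
    ∃ α β : ℕ → ℕ → ℝ,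
      (∀ i k, k < i → i ≤ s → 0 < α i k) ∧
      (∀ i, 1 ≤ i → i ≤ s → ∑ k ∈ Finset.range i, α i k = 1) ∧
      (∀ i k, k < i → i ≤ s →
        β i k = a i k - ∑ j ∈ Finset.Ico (k + 1) i, α i j * a j k) ∧
      (∀ i k, k < i → i ≤ s → 0 ≤ β i k) := by
  obtain ⟨ε, hε, hlt⟩ := exists_pos_forall_mul_lt
    (Finset.range (s + 1) ×ˢ Finset.range (s + 1))
    (fun x => max s (∑ j ∈ Finset.Ico (x.2 + 1) x.1, a j x.2))
    (fun x => if x.2 < x.1 then min 1 (a x.1 x.2) else 1)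
    (fun x hx => by
      simp only [Finset.mem_product, Finset.mem_range] at hx
      split_ifs with h
      · exact lt_min one_pos (ha _ _ h (by omega))
      · exact one_pos)
  have hbound : ∀ i k, k < i → i ≤ s →
      ε * s < 1 ∧ ε * ∑ j ∈ Finset.Ico (k + 1) i, a j k < a i k := by
    intro i k hk hi
    have h := hlt (i, k) (by simp only [Finset.mem_product, Finset.mem_range]; omega)
    simp only [hk, if_true, lt_min_iff] at h
    exact ⟨(mul_le_mul_of_nonneg_left (le_max_left _ _) hε.le).trans_lt h.1,
      (mul_le_mul_of_nonneg_left (le_max_right _ _) hε.le).trans_lt h.2⟩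
  let α : ℕ → ℕ → ℝ := fun i j => if j = 0 then 1 - ((i : ℝ) - 1) * ε else ε
  refine ⟨α, fun i k => a i k - ∑ j ∈ Finset.Ico (k + 1) i, α i j * a j k,
    ?_, ?_, fun _ _ _ _ => rfl, ?_⟩
  · intro i k hk hi
    have hs' := (hbound i k hk hi).1
    have hi' : (i : ℝ) ≤ s := by exact_mod_cast hi
    simp only [α]
    split_ifs
    · nlinarith
    · exact hε
  · intro i hi _
    obtain ⟨n, rfl⟩ := Nat.exists_eq_add_of_le' hi
    simp [α, Finset.sum_range_succ']
  · intro i k hk hi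
    have hα : ∑ j ∈ Finset.Ico (k + 1) i, α i j * a j k
        = ε * ∑ j ∈ Finset.Ico (k + 1) i, a j k := by
      rw [Finset.mul_sum]
      refine Finset.sum_congr rfl fun j hj => ?_
      have hj0 : j ≠ 0 := by have := (Finset.mem_Ico.mp hj).1; omega
      simp [α, hj0]
    beta_reduce
    rw [hα]
    exact sub_nonneg.mpr (hbound i k hk hi).2.le
end

section
/- Let s ≥ 1 and let a_{ik} (for 0 ≤ k < i ≤ s) be real numbers with all sub-diagonal entries nonzero, i.e. a_{i,i−1} ≠ 0 for every 1 ≤ i ≤ s. Then the associated explicit Runge–Kutta method satisfies the RK-SSP condition if and only if a_{ik} > 0 for all 0 ≤ k < i ≤ s. -/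
open Filter Topology in
/-- Finitely many strict inequalities `ε * S i k < a i k` with positive right-hand sides, together
with `ε * s < 1`, can be satisfied by one positive `ε`. -/
theorem exists_pos_forall_mul_lt_s1 (s : ℕ) (S a : ℕ → ℕ → ℝ)
    (ha : ∀ i k, k < i → i ≤ s → 0 < a i k) :
    ∃ ε : ℝ, 0 < ε ∧ ε * s < 1 ∧ ∀ i k, k < i → i ≤ s → ε * S i k < a i k := by
  have small (c d : ℝ) (hd : 0 < d) : ∀ᶠ ε in 𝓝[>] (0 : ℝ), ε * c < d := by
    have hc : Continuous fun ε : ℝ => ε * c := by fun_prop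
    exact (hc.continuousAt.eventually_lt_const (by simpa using hd)).filter_mono
      nhdsWithin_le_nhds
  have h : ∀ᶠ ε in 𝓝[>] (0 : ℝ), ∀ i ∈ Finset.range (s + 1), ∀ k ∈ Finset.range i,
      ε * S i k < a i k := by
    simp only [eventually_all_finset]
    intro i hi k hk
    exact small _ _ (ha i k (Finset.mem_range.1 hk) (by grind))
  have hpos : ∀ᶠ ε in 𝓝[>] (0 : ℝ), 0 < ε := self_mem_nhdsWithin
  obtain ⟨ε, hε, hs, hS⟩ := (hpos.and ((small s 1 one_pos).and h)).exists
  exact ⟨ε, hε, hs, fun i k hk hi => hS i (by grind) k (by grind)⟩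


/-- An explicit Runge–Kutta method with nonzero sub-diagonal
Butcher entries satisfies the RK-SSP condition if and only if all strictly
lower-triangular Butcher coefficients are positive. -/
theorem rk_ssp_iff_positive_butcher
    (s : ℕ) (hs : 1 ≤ s) (a : ℕ → ℕ → ℝ)
    (hsub : ∀ i, 1 ≤ i → i ≤ s → a i (i - 1) ≠ 0) :
    (∃ α β : ℕ → ℕ → ℝ,
      (∀ i k, k < i → i ≤ s → 0 ≤ α i k) ∧
      (∀ i k, k < i → i ≤ s → 0 ≤ β i k) ∧
      (∀ i k, k < i → i ≤ s → α i k = 0 → β i k = 0) ∧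
      (∀ i, 1 ≤ i → i ≤ s → ∑ k ∈ Finset.range i, α i k = 1) ∧
      (∀ i k, k < i → i ≤ s →
        β i k = a i k - ∑ j ∈ Finset.Ico (k + 1) i, α i j * a j k)) ↔
    (∀ i k, k < i → i ≤ s → 0 < a i k) := by
  constructor
  · rintro ⟨α, β, hα, hβ, hαβ, -, hdef⟩ i
    induction i using Nat.strong_induction_on with
    | _ i ih =>
      intro k hk hi
      have hlt : i - 1 < i := by omega
      have hdiag : β i (i - 1) = a i (i - 1) := by
        rw [hdef i (i - 1) hlt hi, Finset.Ico_eq_empty (by omega), Finset.sum_empty, sub_zero]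
      have hne : a i (i - 1) ≠ 0 := hsub i (by omega) hi
      obtain rfl | hk' : k = i - 1 ∨ k < i - 1 := by omega
      · exact lt_of_le_of_ne (hdiag ▸ hβ i _ hlt hi) hne.symm
      · have hαpos : 0 < α i (i - 1) :=
          lt_of_le_of_ne (hα i _ hlt hi) fun h0 =>
            hne (hdiag ▸ hαβ i _ hlt hi h0.symm)
        have hsum : 0 < ∑ j ∈ Finset.Ico (k + 1) i, α i j * a j k := by
          refine Finset.sum_pos' (fun j hj => ?_) ⟨i - 1, ?_, ?_⟩
          · rw [Finset.mem_Ico] at hj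
            exact mul_nonneg (hα i j hj.2 hi) (ih j hj.2 k (by omega) (by omega)).le
          · rw [Finset.mem_Ico]; omega
          · exact mul_pos hαpos (ih _ hlt k hk' (by omega))
        linarith [hβ i k hk hi, hdef i k hk hi]
  · intro ha
    obtain ⟨ε, hε, hεs, hS⟩ :=
      exists_pos_forall_mul_lt_s1 s (fun i k => ∑ j ∈ Finset.Ico (k + 1) i, a j k) a ha
    let α : ℕ → ℕ → ℝ := fun i k => if k = 0 then 1 - ((i : ℝ) - 1) * ε else ε
    have hαpos : ∀ i k, i ≤ s → 0 < α i k := by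
      intro i k hi
      have hi' : (i : ℝ) ≤ s := by exact_mod_cast hi
      dsimp only [α]
      split_ifs
      · nlinarith
      · exact hε
    have hαsum : ∀ i k, ∑ j ∈ Finset.Ico (k + 1) i, α i j * a j k
        = ε * ∑ j ∈ Finset.Ico (k + 1) i, a j k := by
      intro i k
      rw [Finset.mul_sum]
      refine Finset.sum_congr rfl fun j hj => ?_
      have hj0 : j ≠ 0 := by grind
      simp [α, hj0]
    refine ⟨α, fun i k => a i k - ∑ j ∈ Finset.Ico (k + 1) i, α i j * a j k,
      fun i k _ hi => (hαpos i k hi).le, fun i k hk hi => ?_,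
      fun i k _ hi h0 => absurd h0 (hαpos i k hi).ne', fun i hi _ => ?_, fun _ _ _ _ => rfl⟩
    · beta_reduce
      rw [hαsum]
      exact sub_nonneg.2 (hS i k hk hi).le
    · obtain ⟨n, rfl⟩ := Nat.exists_eq_add_of_le' hi
      simp [Finset.sum_range_succ', α]
end

section
/- Let V be a real vector space equipped with a seminorm ‖·‖, let G : V → V, and suppose there is τ₀ > 0 such that the forward Euler step is strongly stable: ‖v + τ' G(v)‖ ≤ ‖v‖ for every v ∈ V and every 0 ≤ τ' ≤ τ₀. Let α_{ik}, β_{ik} (0 ≤ k < i ≤ s) satisfy α_{ik} ≥ 0, β_{ik} ≥ 0, β_{ik} = 0 whenever α_{ik} = 0, and Σ_{k=0}^{i−1} α_{ik} = 1 for each 1 ≤ i ≤ s. Let τ > 0 satisfy τ β_{ik} ≤ α_{ik} τ₀ for all i,k. Then the stages of the Shu–Osher scheme, defined by v_0 = u_n and v_i = Σ_{k=0}^{i−1} (α_{ik} v_k + τ β_{ik} G(v_k)) for 1 ≤ i ≤ s, satisfy ‖v_i‖ ≤ ‖u_n‖ for every i; in particular the output u_{n+1} = v_s satisfies ‖u_{n+1}‖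 ≤ ‖u_n‖. -/
/-- If the forward Euler step is strongly stable in a seminorm `p`
for step sizes up to `τ₀`, and the Shu–Osher coefficients `(α, β)` satisfy the
RK-SSP condition, then under the time-step restriction `τ * β i k ≤ α i k * τ₀`
all stages of the Shu–Osher scheme satisfy `p (v i) ≤ p uₙ`; in particular the
output `u_{n+1} = v s` satisfies `p u_{n+1} ≤ p uₙ`. -/
theorem shu_osher_strong_stability
    {V : Type*} [AddCommGroup V] [Module ℝ V] (p : Seminorm ℝ V)
    (G : V → V) (τ₀ : ℝ) (hτ₀ : 0 < τ₀)
    (hFE : ∀ v : V, ∀ τ' : ℝ, 0 ≤ τ' → τ' ≤ τ₀ → p (v + τ' • G v) ≤ p v)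
    (s : ℕ) (α β : ℕ → ℕ → ℝ)
    (hα : ∀ i k, k < i → i ≤ s → 0 ≤ α i k)
    (hβ : ∀ i k, k < i → i ≤ s → 0 ≤ β i k)
    (hzero : ∀ i k, k < i → i ≤ s → α i k = 0 → β i k = 0)
    (hsum : ∀ i, 1 ≤ i → i ≤ s → ∑ k ∈ Finset.range i, α i k = 1)
    (τ : ℝ) (hτ : 0 < τ)
    (hstep : ∀ i k, k < i → i ≤ s → τ * β i k ≤ α i k * τ₀)
    (un : V) (v : ℕ → V) (hv0 : v 0 = un)
    (hv : ∀ i, 1 ≤ i → i ≤ s →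
      v i = ∑ k ∈ Finset.range i, (α i k • v k + (τ * β i k) • G (v k))) :
    ∀ i, i ≤ s → p (v i) ≤ p un := by
  intro i
  induction i using Nat.strong_induction_on with
  | _ i ih =>
    intro hi
    rcases Nat.eq_zero_or_pos i with rfl | hpos
    · rw [hv0]
    have hterm : ∀ k ∈ Finset.range i,
        p (α i k • v k + (τ * β i k) • G (v k)) ≤ α i k * p un := by
      intro k hk
      have hki : k < i := Finset.mem_range.mp hk
      rcases (hα i k hki hi).eq_or_lt with h0 | hα_pos
      · simp [← h0, hzero i k hki hi h0.symm]
      have hβτ : 0 ≤ τ * β i k := mul_nonneg hτ.le (hβ i k hki hi)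
      have hEuler : p (v k + (τ * β i k / α i k) • G (v k)) ≤ p (v k) :=
        hFE _ _ (div_nonneg hβτ hα_pos.le)
          ((div_le_iff₀' hα_pos).mpr (hstep i k hki hi))
      calc p (α i k • v k + (τ * β i k) • G (v k))
          = p (α i k • (v k + (τ * β i k / α i k) • G (v k))) := by
            rw [smul_add, smul_smul, mul_div_cancel₀ _ hα_pos.ne']
        _ = α i k * p (v k + (τ * β i k / α i k) • G (v k)) := by
            rw [map_smul_eq_mul, Real.norm_of_nonneg hα_pos.le]
        _ ≤ α i k * p un :=
            mul_le_mul_of_nonneg_left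
              (hEuler.trans (ih k hki (hki.le.trans hi))) hα_pos.le
    calc p (v i) = p (∑ k ∈ Finset.range i, (α i k • v k + (τ * β i k) • G (v k))) := by
          rw [← hv i hpos hi]
      _ ≤ ∑ k ∈ Finset.range i, p (α i k • v k + (τ * β i k) • G (v k)) :=
          Finset.le_sum_of_subadditive p (map_zero p).le (map_add_le_add p) _ _
      _ ≤ ∑ k ∈ Finset.range i, α i k * p un := Finset.sum_le_sum hterm
      _ = p un := by rw [← Finset.sum_mul, hsum i hpos hi, one_mul]
end

section
/- Let a > 0 and let c be a real number with −4a ≤ c ≤ a/2. Then the function g(x) = a x + c (x − x³) satisfies |g(x)| ≤ a for every x ∈ [−1, 1]. -/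
theorem cubic_le_of_mem_Icc {a c x : ℝ} (hc₁ : -4 * a ≤ c) (hc₂ : c ≤ a / 2)
    (hx : x ∈ Set.Icc (-1 : ℝ) 1) : a * x + c * (x - x ^ 3) ≤ a := by
  obtain ⟨hx₁, hx₂⟩ := hx
  have hlow : -1 / 4 ≤ x * (1 + x) := by nlinarith [sq_nonneg (x + 1 / 2)]
  have hupp : x * (1 + x) ≤ 2 := by nlinarith
  have key : c * (x * (1 + x)) ≤ a := by
    rcases le_total 0 c with hc | hc <;> nlinarith
  have hfac : 0 ≤ (1 - x) * (a - c * (x * (1 + x))) :=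
    mul_nonneg (by linarith) (by linarith)
  linarith

/-- If `a > 0` and `-4a ≤ c ≤ a/2`, then `g(x) = a·x + c·(x - x³)`
satisfies `|g(x)| ≤ a` for every `x ∈ [-1, 1]`. -/
theorem cubic_stability_bound
    (a c : ℝ) (ha : 0 < a) (hc₁ : -4 * a ≤ c) (hc₂ : c ≤ a / 2)
    (x : ℝ) (hx : x ∈ Set.Icc (-1 : ℝ) 1) :
    |a * x + c * (x - x ^ 3)| ≤ a := by
  have hneg : -x ∈ Set.Icc (-1 : ℝ) 1 := ⟨by linarith [hx.2], by linarith [hx.1]⟩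
  have hupp := cubic_le_of_mem_Icc hc₁ hc₂ hx
  have hlow := cubic_le_of_mem_Icc hc₁ hc₂ hneg
  exact abs_le.mpr ⟨by linarith, hupp⟩
end

section
/- Let N ≥ 3, h = 2π/N, let D be the periodic central-difference Laplacian matrix, let ε > 0, and define G : ℝ^N → ℝ^N by G(u) = ε D u + (1/ε)(u − u.³), where u.³ is the componentwise cube. If 0 < τ ≤ min{h²/(4ε), ε/4}, then for every u ∈ ℝ^N with ‖u‖_∞ ≤ 1 one has ‖u + τ G(u)‖_∞ ≤ 1. (Thus the forward Euler step for the finite-difference semi-discrete Allen–Cahn equation preserves the maximum bound.) -/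
/-- The periodic central-difference Laplacian matrix on `Fin N` with mesh size `h`:
diagonal entries `-2/h²`, entries `1/h²` at positions `(j, j±1 mod N)`, `0` elsewhere. -/
noncomputable def periodicLap (N : ℕ) (h : ℝ) : Matrix (Fin N) (Fin N) ℝ :=
  Matrix.of fun i j =>
    if (j : ℕ) = (i : ℕ) then -2 / h ^ 2
    else if (j : ℕ) = ((i : ℕ) + 1) % N ∨ ((j : ℕ) + 1) % N = (i : ℕ) then 1 / h ^ 2
    else 0

lemma Nat.succ_mod_eq_ite {N i : ℕ} (hi : i < N) :
    (i + 1) % N = if i + 1 = N then 0 else i + 1 := by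
  split_ifs with h
  · rw [h, Nat.mod_self]
  · exact Nat.mod_eq_of_lt (by omega)

/-- Each row of `periodicLap` is the three-point central-difference stencil. -/
lemma exists_periodicLap_mulVec_eq {N : ℕ} (hN : 3 ≤ N) (h : ℝ) (u : Fin N → ℝ) (i : Fin N) :
    ∃ p q : Fin N, (periodicLap N h).mulVec u i = (u p + u q - 2 * u i) / h ^ 2 := by
  obtain ⟨i, hi⟩ := i
  let p : Fin N := ⟨if i + 1 = N then 0 else i + 1, by split_ifs <;> omega⟩
  let q : Fin N := ⟨if i = 0 then N - 1 else i - 1, by split_ifs <;> omega⟩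
  refine ⟨p, q, ?_⟩
  have entry (j : Fin N) : periodicLap N h ⟨i, hi⟩ j =
      (if j = ⟨i, hi⟩ then -2 / h ^ 2 else 0) + (if j = p then 1 / h ^ 2 else 0) +
        (if j = q then 1 / h ^ 2 else 0) := by
    obtain ⟨j, hj⟩ := j
    simp only [periodicLap, Matrix.of_apply, p, q, Fin.mk.injEq, Nat.succ_mod_eq_ite hi,
      Nat.succ_mod_eq_ite hj]
    split_ifs <;> first | omega | simp
  simp only [Matrix.mulVec, dotProduct, entry, add_mul, ite_mul, zero_mul,
    Finset.sum_add_distrib, Finset.sum_ite_eq', Finset.mem_univ, if_true]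
  ring

/-- The scalar maximum bound: `x` is the value at a node and `s` the sum over its neighbours. -/
lemma allenCahn_step_le_one {a b x s : ℝ} (ha : 0 ≤ a) (ha' : a ≤ 1 / 4) (hb : 0 ≤ b)
    (hb' : b ≤ 1 / 4) (hx : -1 ≤ x) (hx' : x ≤ 1) (hs : s ≤ 2) :
    x + (a * (s - 2 * x) + b * (x - x ^ 3)) ≤ 1 := by
  have hx2 : x * (1 + x) ≤ 2 := by nlinarith
  have hbx : b * (x * (1 + x)) ≤ 1 / 2 := by nlinarith
  have hprod : 0 ≤ (1 - x) * (1 - 2 * a - b * (x * (1 + x))) :=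
    mul_nonneg (by linarith) (by linarith)
  have has : a * s ≤ a * 2 := mul_le_mul_of_nonneg_left hs ha
  linarith

/-- For `N ≥ 3`, `h = 2π/N`, `ε > 0`,
`G(u) = ε D u + (1/ε)(u - u.³)` and `0 < τ ≤ min{h²/(4ε), ε/4}`, the forward
Euler step preserves the maximum bound: `‖u‖_∞ ≤ 1 → ‖u + τ G(u)‖_∞ ≤ 1`.
(The sup norm is the default norm on `Fin N → ℝ`.) -/
theorem forward_euler_MBP
    (N : ℕ) (hN : 3 ≤ N) (ε : ℝ) (hε : 0 < ε) (τ : ℝ) (hτ : 0 < τ)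
    (hτ' : τ ≤ min ((2 * Real.pi / N) ^ 2 / (4 * ε)) (ε / 4))
    (u : Fin N → ℝ) (hu : ‖u‖ ≤ 1) :
    ‖u + τ • (ε • (periodicLap N (2 * Real.pi / N)).mulVec u +
        ε⁻¹ • (fun j => u j - (u j) ^ 3))‖ ≤ 1 := by
  have hNpos : (0 : ℝ) < N := by exact_mod_cast (by omega : 0 < N)
  have hh : 0 < 2 * Real.pi / (N : ℝ) := by positivity
  obtain ⟨hτ₁, hτ₂⟩ := le_min_iff.mp hτ'
  generalize 2 * Real.pi / (N : ℝ) = h at *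
  have ha' : τ * ε / h ^ 2 ≤ 1 / 4 := by
    rw [le_div_iff₀ (by positivity)] at hτ₁
    rw [div_le_iff₀ (by positivity)]
    linarith
  have hb' : τ / ε ≤ 1 / 4 := by
    rw [div_le_iff₀ hε]
    linarith
  have ha : 0 ≤ τ * ε / h ^ 2 := by positivity
  have hb : 0 ≤ τ / ε := by positivity
  have hu' (j : Fin N) : -1 ≤ u j ∧ u j ≤ 1 := abs_le.mp ((norm_le_pi_norm u j).trans hu)
  refine (pi_norm_le_iff_of_nonneg zero_le_one).mpr fun i => ?_
  obtain ⟨p, q, hpq⟩ := exists_periodicLap_mulVec_eq hN h u i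
  have hv : (u + τ • (ε • (periodicLap N h).mulVec u + ε⁻¹ • (fun j => u j - (u j) ^ 3))) i =
      u i + (τ * ε / h ^ 2 * ((u p + u q) - 2 * u i) + τ / ε * (u i - u i ^ 3)) := by
    simp only [Pi.add_apply, Pi.smul_apply, smul_eq_mul, hpq]
    ring
  obtain ⟨hi, hi'⟩ := hu' i
  obtain ⟨hp, hp'⟩ := hu' p
  obtain ⟨hq, hq'⟩ := hu' q
  rw [hv, Real.norm_eq_abs, abs_le]
  constructor
  · have := allenCahn_step_le_one (x := -u i) (s := -(u p + u q)) ha ha' hb hb'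
      (by linarith) (by linarith) (by linarith)
    linarith
  · exact allenCahn_step_le_one ha ha' hb hb' hi hi' (by linarith)
end

section
/- Let s ≥ 1 and let a_{ik} (0 ≤ k < i ≤ s) be Butcher coefficients of an explicit Runge–Kutta method such that all sub-diagonal entries a_{j,j−1} for 1 ≤ j ≤ s−1 are nonzero. Then there exist real numbers p_{ik} (0 ≤ k < i ≤ s) with Σ_{k=0}^{i−1} p_{ik} = 1 for each i, such that for every real vector space V, every map G : V → V, every τ ∈ ℝ, and every v_0 ∈ V, the Runge–Kutta stages v_i = v_0 + τ Σ_{j=0}^{i−1} a_{ij} G(v_j) (1 ≤ i ≤ s) satisfy the one-derivative recursion v_i = Σ_{k=0}^{i−1} p_{ik} v_k + a_{i,i−1} τ G(v_{i−1}) for every 1 ≤ i ≤ s. -/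
/-- If the sub-diagonal entries `a (j + 1) j`, `j < n`, are nonzero, then every combination
`v 0 + τ Σ_{j<n} c j • g j` of the increments is an affine combination of the stages
`v 0, …, v n`, with weights depending only on `a` and `c`. -/
theorem exists_affine_combination_stages.{u} (a : ℕ → ℕ → ℝ) (n : ℕ)
    (ha : ∀ j < n, a (j + 1) j ≠ 0) (c : ℕ → ℝ) :
    ∃ q : ℕ → ℝ, ∑ k ∈ Finset.range (n + 1), q k = 1 ∧
      ∀ (V : Type u) [AddCommGroup V] [Module ℝ V] (g : ℕ → V) (τ : ℝ) (v : ℕ → V),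
        (∀ i, 1 ≤ i → i ≤ n → v i = v 0 + τ • ∑ j ∈ Finset.range i, a i j • g j) →
        v 0 + τ • ∑ j ∈ Finset.range n, c j • g j = ∑ k ∈ Finset.range (n + 1), q k • v k := by
  induction n generalizing c with
  | zero => exact ⟨fun _ => 1, by simp, by simp⟩
  | succ n ih =>
    set μ : ℝ := c n / a (n + 1) n with hμ
    have hc : c n = μ * a (n + 1) n := by rw [hμ, div_mul_cancel₀ _ (ha n n.lt_succ_self)]
    obtain ⟨q, hq, hv⟩ := ih (fun j hj => ha j (by omega)) (fun j => c j - μ * a (n + 1) j)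
    refine ⟨fun k => if k = n + 1 then μ else q k - if k = 0 then μ else 0, ?_, ?_⟩
    · rw [Finset.sum_range_succ, Finset.sum_congr rfl fun k hk =>
        if_neg (Finset.mem_range.mp hk).ne, Finset.sum_sub_distrib, hq]
      simp
    · intro V _ _ g τ v h
      have hprev := hv V g τ v fun i h1 h2 => h i h1 (by omega)
      have hlast := h (n + 1) (by omega) le_rfl
      have hsum : ∑ k ∈ Finset.range (n + 1),
          (if k = n + 1 then μ else q k - if k = 0 then μ else 0) • v k =
          (∑ k ∈ Finset.range (n + 1), q k • v k) - μ • v 0 := by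
        rw [Finset.sum_congr rfl fun k hk => by rw [if_neg (Finset.mem_range.mp hk).ne, sub_smul],
          Finset.sum_sub_distrib]
        simp
      rw [Finset.sum_range_succ _ (n + 1), hsum, ← hprev]
      beta_reduce
      rw [if_pos rfl, hlast, Finset.sum_range_succ, Finset.sum_range_succ, hc]
      simp only [sub_smul, mul_smul, Finset.sum_sub_distrib, ← Finset.smul_sum]
      module


/-- For an explicit Runge–Kutta method whose sub-diagonal Butcher
entries `a j (j-1)` are nonzero for `1 ≤ j ≤ s - 1`, there exist coefficients
`p i k` with `Σ_{k<i} p i k = 1` such that, for every real vector space `V`,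
map `G : V → V`, step `τ` and initial stage `v 0`, the Runge–Kutta stages
`v i = v 0 + τ Σ_{j<i} a i j • G (v j)` satisfy the one-derivative recursion
`v i = Σ_{k<i} p i k • v k + (a i (i-1) * τ) • G (v (i-1))`. -/
theorem rk_one_derivative_form
    (s : ℕ) (hs : 1 ≤ s) (a : ℕ → ℕ → ℝ)
    (hsub : ∀ j, 1 ≤ j → j ≤ s - 1 → a j (j - 1) ≠ 0) :
    ∃ p : ℕ → ℕ → ℝ,
      (∀ i, 1 ≤ i → i ≤ s → ∑ k ∈ Finset.range i, p i k = 1) ∧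
      (∀ (V : Type*) [AddCommGroup V] [Module ℝ V]
        (G : V → V) (τ : ℝ) (v : ℕ → V),
        (∀ i, 1 ≤ i → i ≤ s →
          v i = v 0 + τ • ∑ j ∈ Finset.range i, a i j • G (v j)) →
        (∀ i, 1 ≤ i → i ≤ s →
          v i = (∑ k ∈ Finset.range i, p i k • v k) +
            (a i (i - 1) * τ) • G (v (i - 1)))) := by
  choose! p hp using fun i (h1 : 1 ≤ i) (h2 : i ≤ s) =>
    exists_affine_combination_stages a (i - 1)
      (fun j hj => hsub (j + 1) (by omega) (by omega)) (a i)
  refine ⟨p, fun i h1 h2 => ?_, fun V _ _ G τ v h i h1 h2 => ?_⟩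
  · simpa only [Nat.sub_add_cancel h1] using (hp i h1 h2).1
  · have hstages := (hp i h1 h2).2 V (fun j => G (v j)) τ v
      fun k hk1 hk2 => h k hk1 (by omega)
    rw [Nat.sub_add_cancel h1] at hstages
    rw [← hstages, h i h1 h2]
    obtain ⟨m, rfl⟩ := Nat.exists_eq_add_of_le' h1
    rw [Finset.sum_range_succ, Nat.add_sub_cancel]
    module
end

section
/- Let N ≥ 3, h = 2π/N, let D be the periodic central-difference Laplacian matrix, let ε > 0, and let G(u) = ε D u + (1/ε)(u − u.³). Let s ≥ 1 and let p_{ik} (0 ≤ k < i ≤ s) and d_i > 0 (1 ≤ i ≤ s) satisfy Σ_{k=0}^{i−1} p_{ik} = 1 for each i. Define the s×s matrix Φ by Φ_{ij} = (Σ_{k=0}^{i−1} p_{jk})/d_j for 1 ≤ i ≤ j ≤ s and Φ_{ij} = 0 for i > j, and set Δ_E = (Φ + Φᵀ)/2. Suppose Δ_E is positive definite with smallest eigenvalue λ, and suppose 0 < τ ≤ λ/(1/ε + 2ε/h²). Then for any stages v_0, v_1, …, v_s ∈ ℝ^N satisfying ‖v_i‖_∞ ≤ 1 for all i and the recursion v_i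 = Σ_{k=0}^{i−1} p_{ik} v_k + d_i τ G(v_{i−1}) for 1 ≤ i ≤ s, the discrete energy is non-increasing: E(v_s) ≤ E(v_0), where E(u) = −(ε/2) uᵀ D u + (1/ε) Σ_{j=1}^{N} (1/4)(1 − u_j²)². -/
open Matrix

/-- The semi-discrete Allen–Cahn right-hand side `G(u) = ε D u + (1/ε)(u - u.³)`. -/
noncomputable def allenCahnG (N : ℕ) (h ε : ℝ) (u : Fin N → ℝ) : Fin N → ℝ :=
  ε • (periodicLap N h).mulVec u + ε⁻¹ • (fun j => u j - (u j) ^ 3)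

/-- The discrete Ginzburg–Landau energy
`E(u) = -(ε/2) uᵀ D u + (1/ε) Σⱼ (1/4)(1 - uⱼ²)²`. -/
noncomputable def discreteEnergy (N : ℕ) (h ε : ℝ) (u : Fin N → ℝ) : ℝ :=
  -(ε / 2) * (u ⬝ᵥ (periodicLap N h).mulVec u) +
    (1 / ε) * ∑ j : Fin N, (1 / 4) * (1 - (u j) ^ 2) ^ 2

theorem Matrix.IsHermitian.mul_dotProduct_self_le {n : Type*} [Fintype n] [DecidableEq n]
    {A : Matrix n n ℝ} (hA : A.IsHermitian) {c : ℝ}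
    (hc : ∀ (μ : ℝ) (x : n → ℝ), x ≠ 0 → A *ᵥ x = μ • x → c ≤ μ) (x : n → ℝ) :
    c * (x ⬝ᵥ x) ≤ x ⬝ᵥ A *ᵥ x := by
  have hB : (A - c • (1 : Matrix n n ℝ)).IsHermitian :=
    hA.sub (by simp [Matrix.IsHermitian])
  have hB' : (A - c • (1 : Matrix n n ℝ)).PosSemidef := by
    refine hB.posSemidef_iff_eigenvalues_nonneg.2 fun i => ?_
    have hx : A *ᵥ (hB.eigenvectorBasis i).ofLp =
        (hB.eigenvalues i + c) • (hB.eigenvectorBasis i).ofLp := by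
      have h := hB.mulVec_eigenvectorBasis i
      rw [sub_mulVec, smul_mulVec, one_mulVec, sub_eq_iff_eq_add] at h
      rw [h, add_smul]
    have hne : (hB.eigenvectorBasis i).ofLp ≠ 0 := by
      simpa using hB.eigenvectorBasis.orthonormal.ne_zero i
    have := hc _ _ hne hx
    simp only [Pi.zero_apply]
    linarith
  have h := hB'.dotProduct_mulVec_nonneg x
  simp only [star_trivial, sub_mulVec, smul_mulVec, one_mulVec, dotProduct_sub,
    dotProduct_smul, smul_eq_mul] at h
  linarith

theorem Matrix.dotProduct_symmPart_mulVec {n : Type*} [Fintype n] (A : Matrix n n ℝ)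
    (x : n → ℝ) : x ⬝ᵥ ((1 / 2 : ℝ) • (A + Aᵀ)) *ᵥ x = x ⬝ᵥ A *ᵥ x := by
  rw [smul_mulVec, add_mulVec, dotProduct_smul, dotProduct_add, mulVec_transpose,
    dotProduct_comm x (x ᵥ* A), ← dotProduct_mulVec, smul_eq_mul]
  ring

theorem Matrix.abs_dotProduct_mulVec_le_of_isSymm {n : Type*} [Fintype n] {A : Matrix n n ℝ}
    (hA : A.IsSymm) {c : ℝ} (hc : ∀ i, ∑ j, |A i j| ≤ c) (x : n → ℝ) :
    |x ⬝ᵥ A *ᵥ x| ≤ c * (x ⬝ᵥ x) := by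
  have hterm : ∀ i j, |x i * (A i j * x j)| ≤ |A i j| * (x i ^ 2 + x j ^ 2) / 2 := by
    intro i j
    have : |x i| * |x j| ≤ (x i ^ 2 + x j ^ 2) / 2 := by
      rw [← sq_abs (x i), ← sq_abs (x j)]
      nlinarith [sq_nonneg (|x i| - |x j|)]
    rw [abs_mul, abs_mul]
    nlinarith [mul_le_mul_of_nonneg_left this (abs_nonneg (A i j))]
  have hswap : ∑ i, ∑ j, |A i j| * x j ^ 2 = ∑ i, ∑ j, |A i j| * x i ^ 2 := by
    rw [Finset.sum_comm]
    simp only [hA.apply]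
  calc |x ⬝ᵥ A *ᵥ x| = |∑ i, ∑ j, x i * (A i j * x j)| := by
        simp only [dotProduct, mulVec, Finset.mul_sum]
    _ ≤ ∑ i, ∑ j, |x i * (A i j * x j)| :=
        (Finset.abs_sum_le_sum_abs _ _).trans
          (Finset.sum_le_sum fun i _ => Finset.abs_sum_le_sum_abs _ _)
    _ ≤ ∑ i, ∑ j, |A i j| * (x i ^ 2 + x j ^ 2) / 2 :=
        Finset.sum_le_sum fun i _ => Finset.sum_le_sum fun j _ => hterm i j
    _ = ∑ i, ∑ j, |A i j| * x i ^ 2 := by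
        simp only [mul_add, add_div, Finset.sum_add_distrib, ← Finset.sum_div, hswap]
        ring
    _ ≤ ∑ i, c * x i ^ 2 := by
        refine Finset.sum_le_sum fun i _ => ?_
        rw [← Finset.sum_mul]
        exact mul_le_mul_of_nonneg_right (hc i) (sq_nonneg _)
    _ = c * (x ⬝ᵥ x) := by simp only [dotProduct, Finset.mul_sum, sq]

theorem periodicLap_isSymm (N : ℕ) (h : ℝ) : (periodicLap N h).IsSymm := by
  ext i j
  simp only [periodicLap, transpose_apply, of_apply, eq_comm (a := (i : ℕ)) (b := (j : ℕ)),
    eq_comm (a := (i : ℕ)) (b := ((j : ℕ) + 1) % N),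
    eq_comm (b := (j : ℕ)) (a := ((i : ℕ) + 1) % N),
    or_comm (a := ((j : ℕ) + 1) % N = i)]

theorem sum_abs_periodicLap_le (N : ℕ) (h : ℝ) (i : Fin N) :
    ∑ j, |periodicLap N h i j| ≤ 4 / h ^ 2 := by
  have hN : 0 < N := i.pos
  let next : Fin N := ⟨(i + 1) % N, Nat.mod_lt _ hN⟩
  let prev : Fin N := ⟨(i + (N - 1)) % N, Nat.mod_lt _ hN⟩
  have hprev : ∀ j : Fin N, ((j : ℕ) + 1) % N = i → j = prev := by
    intro j hj
    ext
    simp only [prev, ← hj, Nat.mod_add_mod]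
    rw [add_assoc, Nat.add_sub_cancel' hN, Nat.add_mod_right, Nat.mod_eq_of_lt j.2]
  have hentry : ∀ j, |periodicLap N h i j| ≤
      (if j = i then 2 / h ^ 2 else 0) + (if j = next then 1 / h ^ 2 else 0) +
        (if j = prev then 1 / h ^ 2 else 0) := by
    intro j
    have h₂ : (0 : ℝ) ≤ 2 / h ^ 2 := by positivity
    have h₁ : (0 : ℝ) ≤ 1 / h ^ 2 := by positivity
    have hdiag : |(-2 : ℝ) / h ^ 2| = 2 / h ^ 2 := by
      rw [neg_div, abs_neg, abs_of_nonneg h₂]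
    have hnext : (j : ℕ) = (i + 1) % N ↔ j = next := by simp [next, Fin.ext_iff]
    simp only [periodicLap, of_apply, ← Fin.ext_iff, hnext]
    have := hprev j
    split_ifs <;> simp only [hdiag, abs_of_nonneg h₁, abs_zero] <;> grind
  calc ∑ j, |periodicLap N h i j| ≤ _ := Finset.sum_le_sum fun j _ => hentry j
    _ = 4 / h ^ 2 := by
      simp only [Finset.sum_add_distrib, Finset.sum_ite_eq', Finset.mem_univ, if_true]
      ring

theorem doubleWell_sub_le {a b : ℝ} (ha : |a| ≤ 1) (hb : |b| ≤ 1) :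
    (1 / 4) * (1 - b ^ 2) ^ 2 - (1 / 4) * (1 - a ^ 2) ^ 2 ≤
      -((b - a) * (a - a ^ 3)) + (b - a) ^ 2 := by
  have ha2 : a ^ 2 ≤ 1 := (sq_le_one_iff_abs_le_one a).2 ha
  have hb2 : b ^ 2 ≤ 1 := (sq_le_one_iff_abs_le_one b).2 hb
  have hab : 3 * a ^ 2 + 2 * a * b + b ^ 2 ≤ 6 := by nlinarith [sq_nonneg (a - b)]
  nlinarith [mul_nonneg (sq_nonneg (b - a)) (sub_nonneg.2 hab)]

theorem discreteEnergy_sub_le {N : ℕ} {h ε : ℝ} (hε : 0 < ε) {u w : Fin N → ℝ}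
    (hu : ‖u‖ ≤ 1) (hw : ‖w‖ ≤ 1) :
    discreteEnergy N h ε w - discreteEnergy N h ε u ≤
      -((w - u) ⬝ᵥ allenCahnG N h ε u) + (1 / ε + 2 * ε / h ^ 2) * ((w - u) ⬝ᵥ (w - u)) := by
  have hquad : w ⬝ᵥ periodicLap N h *ᵥ w = u ⬝ᵥ periodicLap N h *ᵥ u +
      2 * ((w - u) ⬝ᵥ periodicLap N h *ᵥ u) + (w - u) ⬝ᵥ periodicLap N h *ᵥ (w - u) := by
    have hsymm : u ⬝ᵥ periodicLap N h *ᵥ w = w ⬝ᵥ periodicLap N h *ᵥ u := by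
      rw [dotProduct_comm w, dotProduct_mulVec, ← mulVec_transpose, periodicLap_isSymm N h]
    simp only [mulVec_sub, dotProduct_sub, sub_dotProduct, hsymm]
    ring
  have hlap : -((w - u) ⬝ᵥ periodicLap N h *ᵥ (w - u)) ≤ 4 / h ^ 2 * ((w - u) ⬝ᵥ (w - u)) :=
    (neg_le_abs _).trans
      (abs_dotProduct_mulVec_le_of_isSymm (periodicLap_isSymm N h) (sum_abs_periodicLap_le N h) _)
  have hpot : ∑ j, (1 / 4) * (1 - w j ^ 2) ^ 2 - ∑ j, (1 / 4) * (1 - u j ^ 2) ^ 2 ≤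
      -((w - u) ⬝ᵥ fun j => u j - u j ^ 3) + (w - u) ⬝ᵥ (w - u) := by
    simp only [dotProduct, ← Finset.sum_sub_distrib, ← Finset.sum_neg_distrib,
      ← Finset.sum_add_distrib, Pi.sub_apply, ← sq]
    exact Finset.sum_le_sum fun j _ =>
      doubleWell_sub_le ((norm_le_pi_norm u j).trans hu) ((norm_le_pi_norm w j).trans hw)
  have hlap' := mul_le_mul_of_nonneg_left hlap (half_pos hε).le
  have hpot' := mul_le_mul_of_nonneg_left hpot (inv_pos.2 hε).le
  simp only [discreteEnergy, allenCahnG, dotProduct_add, dotProduct_smul, smul_eq_mul, hquad,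
    one_div]
  simp only [one_div] at hpot'
  ring_nf at hlap' hpot' ⊢
  linarith

theorem sum_range_partialSum_mul_sub (p v : ℕ → ℝ) (n : ℕ) :
    ∑ l ∈ Finset.range n, (∑ k ∈ Finset.range (l + 1), p k) * (v (l + 1) - v l) =
      (∑ k ∈ Finset.range n, p k) * v n - ∑ k ∈ Finset.range n, p k * v k := by
  induction n with
  | zero => simp
  | succ n ih =>
    rw [Finset.sum_range_succ, ih, Finset.sum_range_succ p,
      Finset.sum_range_succ (fun k => p k * v k)]
    ring

/-- Energy dissipation for a maximum-bound-preserving Runge–Kutta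
scheme in one-derivative Shu–Osher form.  If the energy discriminant
`Δ_E = (Φ + Φᵀ)/2` built from the coefficients `p i k`, `d i` is positive
definite with smallest eigenvalue `λ`, and `0 < τ ≤ λ/(1/ε + 2ε/h²)`, then for
any stages `v 0, …, v s` with `‖v i‖_∞ ≤ 1` satisfying the recursion
`v i = Σ_{k<i} p i k • v k + d i τ G(v (i-1))`, the discrete energy is
non-increasing: `E (v s) ≤ E (v 0)`. -/
theorem rk_energy_dissipation
    (N : ℕ) (hN : 3 ≤ N) (ε : ℝ) (hε : 0 < ε)
    (s : ℕ) (hs : 1 ≤ s) (p : ℕ → ℕ → ℝ) (d : ℕ → ℝ)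
    (hd : ∀ i, 1 ≤ i → i ≤ s → 0 < d i)
    (hp : ∀ i, 1 ≤ i → i ≤ s → ∑ k ∈ Finset.range i, p i k = 1)
    (Φ : Matrix (Fin s) (Fin s) ℝ)
    (hΦ : ∀ i j : Fin s, Φ i j =
      if (i : ℕ) ≤ (j : ℕ) then
        (∑ k ∈ Finset.range ((i : ℕ) + 1), p ((j : ℕ) + 1) k) / d ((j : ℕ) + 1)
      else 0)
    (ΔE : Matrix (Fin s) (Fin s) ℝ) (hΔE : ΔE = (1 / 2 : ℝ) • (Φ + Φᵀ))
    (hPD : ΔE.PosDef) (lam : ℝ)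
    (hlam : IsLeast {μ : ℝ | ∃ x : Fin s → ℝ, x ≠ 0 ∧ ΔE.mulVec x = μ • x} lam)
    (τ : ℝ) (hτ : 0 < τ)
    (hτ' : τ ≤ lam / (1 / ε + 2 * ε / (2 * Real.pi / N) ^ 2))
    (v : ℕ → Fin N → ℝ)
    (hbound : ∀ i, i ≤ s → ‖v i‖ ≤ 1)
    (hv : ∀ i, 1 ≤ i → i ≤ s →
      v i = (∑ k ∈ Finset.range i, p i k • v k) +
        (d i * τ) • allenCahnG N (2 * Real.pi / N) ε (v (i - 1))) :
    discreteEnergy N (2 * Real.pi / N) ε (v s) ≤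
      discreteEnergy N (2 * Real.pi / N) ε (v 0) := by
  set h : ℝ := 2 * Real.pi / N
  set C : ℝ := 1 / ε + 2 * ε / h ^ 2
  have hC0 : 0 < C := by positivity
  have hτC : τ * C ≤ lam := (le_div_iff₀ hC0).1 hτ'
  let δ : Fin N → Fin s → ℝ := fun n j => v (j + 1) n - v j n
  have hstage : ∀ n (j : Fin s), τ * allenCahnG N h ε (v j) n = (δ n ᵥ* Φ) j := by
    intro n j
    have hdj := hd (j + 1) (by omega) j.2
    have hrec := congrFun (hv (j + 1) (by omega) j.2) n
    simp only [Pi.add_apply, Finset.sum_apply, Pi.smul_apply, smul_eq_mul,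
      Nat.add_sub_cancel] at hrec
    have habel := sum_range_partialSum_mul_sub (p (j + 1)) (fun k => v k n) (j + 1)
    rw [hp (j + 1) (by omega) j.2, one_mul, hrec, add_sub_cancel_left] at habel
    have hsum : (δ n ᵥ* Φ) j = (∑ l ∈ Finset.range (j + 1),
        (∑ k ∈ Finset.range (l + 1), p (j + 1) k) * (v (l + 1) n - v l n)) / d (j + 1) := by
      let f : ℕ → ℝ := fun l => (v (l + 1) n - v l n) *
        if l ≤ j then (∑ k ∈ Finset.range (l + 1), p (j + 1) k) / d (j + 1) else 0
      calc (δ n ᵥ* Φ) j = ∑ l : Fin s, f l := by simp only [vecMul, dotProduct, hΦ, δ, f]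
        _ = ∑ l ∈ Finset.range s, f l := Fin.sum_univ_eq_sum_range f s
        _ = ∑ l ∈ Finset.range (j + 1), f l := by
          refine (Finset.sum_subset (Finset.range_mono j.2) fun l _ hl => ?_).symm
          have : ¬ l ≤ j := by simpa [Nat.lt_succ_iff] using hl
          simp [f, this]
        _ = _ := by
          rw [Finset.sum_div]
          refine Finset.sum_congr rfl fun l hl => ?_
          have : l ≤ j := Nat.lt_succ_iff.1 (Finset.mem_range.1 hl)
          simp only [f, this, if_true]
          ring
    rw [hsum, habel]
    field_simp
  have hcoer : ∀ n, lam * (δ n ⬝ᵥ δ n) ≤ ∑ j, δ n j * (τ * allenCahnG N h ε (v j) n) := by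
    intro n
    have hray := hPD.isHermitian.mul_dotProduct_self_le
      (fun μ x hx hμ => hlam.2 ⟨x, hx, hμ⟩) (δ n)
    rw [hΔE, dotProduct_symmPart_mulVec, dotProduct_mulVec, dotProduct_comm (_ ᵥ* _)] at hray
    simp only [hstage]
    exact hray
  have htel : discreteEnergy N h ε (v s) - discreteEnergy N h ε (v 0) =
      ∑ j : Fin s, (discreteEnergy N h ε (v (j + 1)) - discreteEnergy N h ε (v j)) := by
    rw [Fin.sum_univ_eq_sum_range
      fun j => discreteEnergy N h ε (v (j + 1)) - discreteEnergy N h ε (v j)]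
    exact (Finset.sum_range_sub (fun j => discreteEnergy N h ε (v j)) s).symm
  have hdec : discreteEnergy N h ε (v s) - discreteEnergy N h ε (v 0) ≤
      ∑ n, (-∑ j, δ n j * allenCahnG N h ε (v j) n + C * (δ n ⬝ᵥ δ n)) := by
    rw [htel]
    calc _ ≤ ∑ j : Fin s, (-((v (j + 1) - v j) ⬝ᵥ allenCahnG N h ε (v j)) +
          C * ((v (j + 1) - v j) ⬝ᵥ (v (j + 1) - v j))) :=
          Finset.sum_le_sum fun j _ =>
            discreteEnergy_sub_le hε (hbound j j.2.le) (hbound (j + 1) j.2)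
      _ = _ := by
        simp only [dotProduct, Pi.sub_apply, δ, Finset.sum_add_distrib, Finset.mul_sum,
          Finset.sum_neg_distrib]
        rw [Finset.sum_comm, Finset.sum_comm (f := fun (j : Fin s) n => C * _)]
  have hnonpos : ∑ n, (-∑ j, δ n j * allenCahnG N h ε (v j) n + C * (δ n ⬝ᵥ δ n)) ≤ 0 := by
    refine Finset.sum_nonpos fun n _ => ?_
    have hδ : 0 ≤ δ n ⬝ᵥ δ n := Finset.sum_nonneg fun j _ => mul_self_nonneg _
    have hc := hcoer n
    simp only [mul_left_comm _ τ, ← Finset.mul_sum] at hc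
    have := mul_le_mul_of_nonneg_right hτC hδ
    refine nonpos_of_mul_nonpos_right (a := τ) ?_ hτ
    linarith
  linarith
end

section
/- Let N ≥ 3, h = 2π/N, let D be the periodic central-difference Laplacian matrix with forward-difference factor D₁, and let ε > 0. If u : ℝ → ℝ^N is differentiable and satisfies the semi-discrete Allen–Cahn system u'(t) = ε D u(t) + (1/ε)(u(t) − u(t).³) for all t, then the discrete energy E_h(u) = (ε/2) ‖D₁ u‖² + (1/(4ε)) Σ_{j=1}^{N} (1 − u_j²)² satisfies d/dt E_h(u(t)) = −‖u'(t)‖² ≤ 0 for all t, where ‖·‖ is the Euclidean norm on ℝ^N. -/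
open Matrix

/-- The periodic forward-difference matrix `D₁` with mesh size `h`:
`(D₁ v)_j = (v_{(j+1) mod N} - v_j)/h`. -/
noncomputable def periodicFwdDiff (N : ℕ) (h : ℝ) : Matrix (Fin N) (Fin N) ℝ :=
  Matrix.of fun i j =>
    if (j : ℕ) = ((i : ℕ) + 1) % N then 1 / h
    else if (j : ℕ) = (i : ℕ) then -1 / h
    else 0

/-- The semi-discrete Ginzburg–Landau energy
`E_h(u) = (ε/2)‖D₁ u‖² + (1/(4ε)) Σⱼ (1 - uⱼ²)²`, the norm being Euclidean. -/
noncomputable def semiDiscreteEnergy (N : ℕ) (h ε : ℝ) (u : Fin N → ℝ) : ℝ :=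
  (ε / 2) * ∑ j : Fin N, ((periodicFwdDiff N h).mulVec u j) ^ 2 +
    (1 / (4 * ε)) * ∑ j : Fin N, (1 - (u j) ^ 2) ^ 2

theorem periodicFwdDiff_mulVec (n : ℕ) (h : ℝ) (v : Fin (n + 3) → ℝ) (i : Fin (n + 3)) :
    (periodicFwdDiff (n + 3) h).mulVec v i = (v (i + 1) - v i) / h := by
  have key : ∀ j : Fin (n + 3), periodicFwdDiff (n + 3) h i j * v j =
      (if j = i + 1 then v j / h else 0) + (if j = i then -v j / h else 0) := by
    intro j
    have h1 : (j : ℕ) = ((i : ℕ) + 1) % (n + 3) ↔ j = i + 1 := by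
      simp [Fin.ext_iff, Fin.val_add]
    have hne : i + 1 ≠ i := by simp
    simp only [periodicFwdDiff, Matrix.of_apply, h1, ← Fin.ext_iff]
    split_ifs with ha hb
    · exact absurd (ha.symm.trans hb) hne
    all_goals ring
  simp only [Matrix.mulVec, dotProduct, key, Finset.sum_add_distrib, Finset.sum_ite_eq',
    Finset.mem_univ, if_true]
  ring

theorem periodicLap_mulVec (n : ℕ) (h : ℝ) (v : Fin (n + 3) → ℝ) (i : Fin (n + 3)) :
    (periodicLap (n + 3) h).mulVec v i = (v (i + 1) - 2 * v i + v (i - 1)) / h ^ 2 := by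
  have key : ∀ j : Fin (n + 3), periodicLap (n + 3) h i j * v j =
      (if j = i then -2 * v j / h ^ 2 else 0) + (if j = i + 1 then v j / h ^ 2 else 0) +
        (if j = i - 1 then v j / h ^ 2 else 0) := by
    intro j
    have h1 : (j : ℕ) = ((i : ℕ) + 1) % (n + 3) ↔ j = i + 1 := by
      simp [Fin.ext_iff, Fin.val_add]
    have h2 : ((j : ℕ) + 1) % (n + 3) = (i : ℕ) ↔ j = i - 1 := by
      rw [eq_sub_iff_add_eq]
      simp [Fin.ext_iff, Fin.val_add]
    have hne : i + 1 ≠ i := by simp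
    have hne' : i - 1 ≠ i := by simp
    have hne'' : i + 1 ≠ i - 1 := by
      intro e
      have e2 : (1 : Fin (n + 3)) + 1 = 0 := by
        have : i + (1 + 1) = i := by rw [← add_assoc, e, sub_add_cancel]
        simpa using this
      simp [Fin.ext_iff, Fin.val_add, Nat.mod_eq_of_lt (show 2 < n + 3 by omega)] at e2
    simp only [periodicLap, Matrix.of_apply, h1, h2, ← Fin.ext_iff]
    by_cases ha : j = i
    · subst ha
      simp [hne.symm, hne'.symm]
      ring
    · by_cases hb : j = i + 1
      · subst hb
        simp [hne'']
        ring
      · by_cases hc : j = i - 1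
        · simp [hc, hne', hne''.symm]
          ring
        · simp [ha, hb, hc]
  simp only [Matrix.mulVec, dotProduct, key, Finset.sum_add_distrib, Finset.sum_ite_eq',
    Finset.mem_univ, if_true]
  ring

/-- Periodic summation by parts: `D = -D₁ᵀ D₁` as a bilinear form. -/
theorem sum_periodicFwdDiff_mul (n : ℕ) (h : ℝ) (v w : Fin (n + 3) → ℝ) :
    ∑ j, (periodicFwdDiff (n + 3) h).mulVec v j * (periodicFwdDiff (n + 3) h).mulVec w j =
      -∑ j, (periodicLap (n + 3) h).mulVec v j * w j := by
  simp only [periodicFwdDiff_mulVec, periodicLap_mulVec]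
  have hshift := Equiv.sum_comp (Equiv.addRight (1 : Fin (n + 3)))
    (fun j => (v j - v (j - 1)) * w j / h ^ 2)
  simp only [Equiv.coe_addRight, add_sub_cancel_right] at hshift
  have hl : ∀ j, (v (j + 1) - v j) / h * ((w (j + 1) - w j) / h) =
      (v (j + 1) - v j) * w (j + 1) / h ^ 2 - (v (j + 1) - v j) * w j / h ^ 2 := by
    intro j
    ring
  rw [Finset.sum_congr rfl fun j _ => hl j, Finset.sum_sub_distrib, hshift,
    ← Finset.sum_sub_distrib, ← Finset.sum_neg_distrib]
  refine Finset.sum_congr rfl fun j _ => ?_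
  ring

theorem hasDerivAt_semiDiscreteEnergy (N : ℕ) (h ε : ℝ) {u : ℝ → Fin N → ℝ} {u' : Fin N → ℝ}
    {t : ℝ} (hu : HasDerivAt u u' t) :
    HasDerivAt (fun s => semiDiscreteEnergy N h ε (u s))
      (ε * ∑ j, (periodicFwdDiff N h).mulVec (u t) j * (periodicFwdDiff N h).mulVec u' j -
        ε⁻¹ * ∑ j, (u t j - u t j ^ 3) * u' j) t := by
  have hc := hasDerivAt_pi.1 hu
  have hD : ∀ j, HasDerivAt (fun s => (periodicFwdDiff N h).mulVec (u s) j)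
      ((periodicFwdDiff N h).mulVec u' j) t := fun j => by
    simp only [Matrix.mulVec, dotProduct]
    exact HasDerivAt.fun_sum fun i _ => (hc i).const_mul (periodicFwdDiff N h j i)
  have h1 := (HasDerivAt.fun_sum (u := Finset.univ) fun j _ => (hD j).pow 2).const_mul (ε / 2)
  have h2 := (HasDerivAt.fun_sum (u := Finset.univ) fun j _ =>
    (((hc j).pow 2).const_sub 1).pow 2).const_mul (1 / (4 * ε))
  refine (h1.add h2).congr_deriv ?_
  simp only [Finset.mul_sum, ← Finset.sum_add_distrib, ← Finset.sum_sub_distrib]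
  refine Finset.sum_congr rfl fun j _ => ?_
  simp
  ring

/-- If `u : ℝ → ℝ^N` solves the semi-discrete Allen–Cahn system
`u' = ε D u + (1/ε)(u - u.³)`, then the discrete energy `E_h` dissipates along
the solution: `d/dt E_h(u(t)) = -‖u'(t)‖² ≤ 0` (Euclidean norm). -/
theorem semiDiscrete_energy_dissipation
    (N : ℕ) (hN : 3 ≤ N) (ε : ℝ) (hε : 0 < ε)
    (u : ℝ → Fin N → ℝ)
    (hu : ∀ t, HasDerivAt u (allenCahnG N (2 * Real.pi / N) ε (u t)) t) :
    ∀ t, HasDerivAt (fun t' => semiDiscreteEnergy N (2 * Real.pi / N) ε (u t'))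
        (-(∑ j : Fin N, (allenCahnG N (2 * Real.pi / N) ε (u t) j) ^ 2)) t ∧
      -(∑ j : Fin N, (allenCahnG N (2 * Real.pi / N) ε (u t) j) ^ 2) ≤ 0 := by
  obtain ⟨n, rfl⟩ := Nat.exists_eq_add_of_le' hN
  intro t
  refine ⟨(hasDerivAt_semiDiscreteEnergy _ _ _ (hu t)).congr_deriv ?_,
    neg_nonpos.2 (Finset.sum_nonneg fun j _ => sq_nonneg _)⟩
  rw [sum_periodicFwdDiff_mul, mul_neg, ← neg_add', neg_inj, Finset.mul_sum, Finset.mul_sum,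
    ← Finset.sum_add_distrib]
  refine Finset.sum_congr rfl fun j _ => ?_
  simp only [allenCahnG, Pi.add_apply, Pi.smul_apply, smul_eq_mul]
  ring
end

section
/- The symmetric 3×3 real matrix Δ_E = [[1, 3/2, 1/4], [3/2, 4, 1/4], [1/4, 1/4, 3/2]] is positive definite. -/
open Matrix

/-- The energy discriminant
`Δ_E = [[1, 3/2, 1/4], [3/2, 4, 1/4], [1/4, 1/4, 3/2]]` of a three-stage
third-order SSP Runge–Kutta scheme is positive definite. -/
theorem rk3_energy_discriminant_posDef :
    (!![(1 : ℝ), 3/2, 1/4; 3/2, 4, 1/4; 1/4, 1/4, 3/2]).PosDef := by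
  refine posDef_iff_dotProduct_mulVec.2 ⟨?_, fun {v} hv ↦ ?_⟩
  · ext i j
    fin_cases i <;> fin_cases j <;> simp
  · have sum_sq : star v ⬝ᵥ (!![(1 : ℝ), 3/2, 1/4; 3/2, 4, 1/4; 1/4, 1/4, 3/2] *ᵥ v) =
        (v 0 + 3/2 * v 1 + 1/4 * v 2) ^ 2 + 7/4 * (v 1 - 1/14 * v 2) ^ 2 + 10/7 * v 2 ^ 2 := by
      simp [dotProduct, mulVec, Fin.sum_univ_three]
      ring
    rw [sum_sq]
    by_contra! h
    have h2 : v 2 = 0 := by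
      refine pow_eq_zero_iff two_ne_zero |>.1 ?_
      nlinarith [sq_nonneg (v 0 + 3/2 * v 1 + 1/4 * v 2), sq_nonneg (v 1 - 1/14 * v 2),
        sq_nonneg (v 2)]
    have h1 : v 1 = 0 := by
      refine pow_eq_zero_iff two_ne_zero |>.1 ?_
      simp only [h2] at h
      nlinarith [sq_nonneg (v 0 + 3/2 * v 1 + 1/4 * 0), sq_nonneg (v 1)]
    have h0 : v 0 = 0 := by
      refine pow_eq_zero_iff two_ne_zero |>.1 ?_
      simp only [h1, h2] at h
      nlinarith [sq_nonneg (v 0)]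
    refine hv (funext fun i ↦ ?_)
    fin_cases i
    exacts [h0, h1, h2]
end

section
/- The symmetric 3×3 real matrix Δ_E = [[1, 0, 1], [0, 1, 5/2], [1, 5/2, 6]] has eigenvalues 1, (7 + 3√6)/2 and (7 − 3√6)/2; its smallest eigenvalue (7 − 3√6)/2 is negative, so Δ_E is not positive semidefinite. -/
open Matrix

/-- The energy discriminant of the scheme has an eigenvector for `μ` exactly when `μ` is a root of
its factored characteristic polynomial. -/
lemma energyDiscriminant_exists_eigenvector_iff (μ : ℝ) :
    (∃ x : Fin 3 → ℝ, x ≠ 0 ∧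
      (!![(1 : ℝ), 0, 1; 0, 1, 5/2; 1, 5/2, 6]).mulVec x = μ • x) ↔
      (μ - 1) * (μ ^ 2 - 7 * μ - 5 / 4) = 0 := by
  have hdet : (!![(1 : ℝ), 0, 1; 0, 1, 5/2; 1, 5/2, 6] - μ • 1).det =
      -((μ - 1) * (μ ^ 2 - 7 * μ - 5 / 4)) := by
    simp [det_fin_three, one_apply]
    ring
  rw [← neg_eq_zero, ← hdet, ← exists_mulVec_eq_zero_iff]
  simp only [sub_mulVec, smul_mulVec, one_mulVec, sub_eq_zero]

/-- The energy discriminant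
`Δ_E = [[1, 0, 1], [0, 1, 5/2], [1, 5/2, 6]]` of a particular three-stage
third-order Runge–Kutta scheme has eigenvalues `1`, `(7 + 3√6)/2` and
`(7 - 3√6)/2`; its smallest eigenvalue `(7 - 3√6)/2` is negative, hence `Δ_E`
is not positive semidefinite. -/
theorem rk3_bad_energy_discriminant :
    ({μ : ℝ | ∃ x : Fin 3 → ℝ, x ≠ 0 ∧
        (!![(1 : ℝ), 0, 1; 0, 1, 5/2; 1, 5/2, 6]).mulVec x = μ • x} =
      {1, (7 + 3 * Real.sqrt 6) / 2, (7 - 3 * Real.sqrt 6) / 2}) ∧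
    (7 - 3 * Real.sqrt 6) / 2 < 0 ∧
    ¬ (!![(1 : ℝ), 0, 1; 0, 1, 5/2; 1, 5/2, 6]).PosSemidef := by
  have hsq : Real.sqrt 6 ^ 2 = 6 := Real.sq_sqrt (by norm_num)
  refine ⟨?_, ?_, fun h => ?_⟩
  · ext μ
    have hfactor : (μ - 1) * (μ ^ 2 - 7 * μ - 5 / 4) =
        (μ - 1) * ((μ - (7 + 3 * Real.sqrt 6) / 2) * (μ - (7 - 3 * Real.sqrt 6) / 2)) := by
      linear_combination (9 / 4) * (μ - 1) * hsq
    rw [Set.mem_ofPred_eq, energyDiscriminant_exists_eigenvector_iff, hfactor]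
    simp only [Set.mem_insert_iff, Set.mem_singleton_iff, mul_eq_zero, sub_eq_zero]
  · nlinarith [Real.sqrt_nonneg 6]
  · have hdet := h.det_nonneg
    simp [det_fin_three] at hdet
    norm_num at hdet
end
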